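/- There are no integers x, y, d with x ≥ 2, y ≥ 1, d ≥ 1 such that d = x³ − 2·x·y and 17·d + 124·y = −17·x³ + 303·x² − 969·x + 1153. -/

import Mathlib

theorem no_solutions_P3_ell4 :
    ¬ ∃ x y d : ℤ, 2 ≤ x ∧ 1 ≤ y ∧ 1 ≤ d ∧ d = x ^ 3 - 2 * x * y ∧
      17 * d + 124 * y = -17 * x ^ 3 + 303 * x ^ 2 - 969 * x + 1153 := by
  rintro ⟨x, y, d, -, -, -, hd, h⟩
  subst hd
  obtain ⟨k, hk⟩ := Int.even_mul_succ_self x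
  have h2 : 2 * (17 * x ^ 3 - 17 * (x * y) + 62 * y - 303 * k + 636 * x) = 1153 := by
    linear_combination h + 303 * hk
  omega
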